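/- Let k be a field with algebraic closure k̄, and let a₁,…,aₙ and b₁,…,bₙ be elements of k̄, none equal to 0 or 1. Suppose a₁a₂⋯aₙ = b₁b₂⋯bₙ and (1−a₁)(1−a₂)⋯(1−aₙ) = (1−b₁)(1−b₂)⋯(1−bₙ), and suppose that the polynomials ∏ᵢ(λ−aᵢ) and ∏ᵢ(λ−bᵢ) have all their coefficients in k (equivalently, all elementary symmetric functions of a₁,…,aₙ and of b₁,…,bₙ lie in k). Then there exists a matrix θ(t) ∈ GLₙ(k[t]) such that 1ₙ − θ(t) is also invertible over k[t], the characteristic polynomial of θ(0) is ∏ᵢ(λ−aᵢ), and the characteristic polynomial of θ(1) is ∏ᵢ(λ−bᵢ); in particular the eigenvalues of θ(0) and θ(1) are a₁,…,aₙ and b₁,…,bₙ respectively. -/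

import Mathlib

universe u

open Polynomial in
/-- Every monic polynomial of degree `n` over a commutative ring is the characteristic polynomial
of some `n × n` matrix. -/
theorem Polynomial.Monic.exists_matrix_charpoly_eq {R : Type*} [CommRing R] {p : R[X]}
    (hp : p.Monic) {n : ℕ} (hn : p.natDegree = n) :
    ∃ M : Matrix (Fin n) (Fin n) R, M.charpoly = p := by
  subst hn
  cases subsingleton_or_nontrivial R
  · exact ⟨0, Subsingleton.elim _ _⟩
  refine ⟨Algebra.leftMulMatrix (AdjoinRoot.powerBasis' hp).basis (AdjoinRoot.powerBasis' hp).gen,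
    ?_⟩
  refine (charpoly_leftMulMatrix (AdjoinRoot.powerBasis' hp)).trans ?_
  rw [AdjoinRoot.powerBasis'_gen]
  symm
  refine minpoly.unique' R _ hp (by simp) fun q hq => ?_
  rw [AdjoinRoot.aeval_eq, Ne, AdjoinRoot.mk_eq_zero]
  exact or_iff_not_imp_left.2 fun h0 => hp.not_dvd_of_degree_lt h0 hq

open Polynomial in
/-- Two monic polynomials of the same degree `n` over a field which agree and do not vanish at
`0` and `1` are the characteristic polynomials of `θ(0)` and `θ(1)` for some
`θ ∈ GLₙ(k[t])` with `1 - θ ∈ GLₙ(k[t])`. -/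
theorem exists_matrix_charpoly_eval_eq {k : Type*} [Field k] {n : ℕ} {p q : k[X]}
    (hp : p.Monic) (hq : q.Monic) (hpn : p.natDegree = n) (hqn : q.natDegree = n)
    (hp0 : p.eval 0 ≠ 0) (hp1 : p.eval 1 ≠ 0)
    (h0 : p.eval 0 = q.eval 0) (h1 : p.eval 1 = q.eval 1) :
    ∃ θ : Matrix (Fin n) (Fin n) k[X],
      IsUnit θ ∧ IsUnit (1 - θ) ∧
      (θ.map (evalRingHom (0 : k))).charpoly = p ∧
      (θ.map (evalRingHom (1 : k))).charpoly = q := by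
  set r : k[X][X] := p.map C + C X * (q - p).map C with hr
  have hdeg : (C X * (q - p).map C : k[X][X]).degree < (p.map C).degree := by
    rw [degree_C_mul X_ne_zero, degree_map_eq_of_injective C_injective,
      degree_map_eq_of_injective C_injective]
    have hd : q.degree = p.degree := by
      rw [degree_eq_natDegree hp.ne_zero, degree_eq_natDegree hq.ne_zero, hpn, hqn]
    exact hd ▸ degree_sub_lt_left hd hq.ne_zero (by rw [hp.leadingCoeff, hq.leadingCoeff])
  have hrm : r.Monic := (hp.map C).add_of_left hdeg
  have hrn : r.natDegree = n := by
    rw [natDegree_eq_of_degree_eq (degree_add_eq_left_of_degree_lt hdeg), natDegree_map, hpn]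
  have heval (x : k) (hx : p.eval x = q.eval x) : r.eval (C x) = C (p.eval x) := by
    simp [hr, eval_map, eval₂_at_apply, hx]
  obtain ⟨θ, hθ⟩ := hrm.exists_matrix_charpoly_eq hrn
  refine ⟨θ, ?_, ?_, ?_, ?_⟩
  · rw [Matrix.isUnit_iff_isUnit_det, Matrix.det_eq_sign_charpoly_coeff, hθ,
      coeff_zero_eq_eval_zero, ← C_0, heval 0 h0]
    exact (isUnit_one.neg.pow _).mul (isUnit_C.2 hp0.isUnit)
  · rw [Matrix.isUnit_iff_isUnit_det, ← map_one (Matrix.scalar (Fin n)), ← Matrix.eval_charpoly,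
      hθ, ← C_1, heval 1 h1]
    exact isUnit_C.2 hp1.isUnit
  · rw [Matrix.charpoly_map, hθ]
    ext i
    simp [hr]
  · rw [Matrix.charpoly_map, hθ]
    ext i
    simp [hr]

/-- **Lemma `basicelements`.**
Let `a₁, …, aₙ` and `b₁, …, bₙ` be elements of an algebraic closure of `k`, none equal
to `0` or `1`, with `∏ aᵢ = ∏ bᵢ` and `∏ (1 − aᵢ) = ∏ (1 − bᵢ)`, and suppose the monic
polynomials `∏ (λ − aᵢ)` and `∏ (λ − bᵢ)` have all their coefficients in `k`.
Then there is a matrix `θ(t) ∈ GLₙ(k[t])` with `1ₙ − θ(t)` invertible over `k[t]`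
such that the characteristic polynomial of `θ(0)` is `∏ (λ − aᵢ)` and that of `θ(1)`
is `∏ (λ − bᵢ)` (so the eigenvalues of `θ(0)`, `θ(1)` are the `aᵢ`, `bᵢ`). -/
theorem exists_matrix_with_prescribed_eigenvalues
    (k : Type u) [Field k] (n : ℕ) (a b : Fin n → AlgebraicClosure k)
    (ha0 : ∀ i, a i ≠ 0) (ha1 : ∀ i, a i ≠ 1)
    (hb0 : ∀ i, b i ≠ 0) (hb1 : ∀ i, b i ≠ 1)
    (hprod : ∏ i, a i = ∏ i, b i)
    (hprod1 : ∏ i, (1 - a i) = ∏ i, (1 - b i))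
    (pa pb : Polynomial k)
    (hpa : pa.map (algebraMap k (AlgebraicClosure k))
      = ∏ i, (Polynomial.X - Polynomial.C (a i)))
    (hpb : pb.map (algebraMap k (AlgebraicClosure k))
      = ∏ i, (Polynomial.X - Polynomial.C (b i))) :
    ∃ θ : Matrix (Fin n) (Fin n) (Polynomial k),
      IsUnit θ ∧ IsUnit (1 - θ) ∧
      (θ.map (Polynomial.evalRingHom (0 : k))).charpoly = pa ∧
      (θ.map (Polynomial.evalRingHom (1 : k))).charpoly = pb := by
  have hmonic {p : Polynomial k} {c : Fin n → AlgebraicClosure k}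
      (h : p.map (algebraMap k (AlgebraicClosure k)) =
        ∏ i, (Polynomial.X - Polynomial.C (c i))) : p.Monic ∧ p.natDegree = n := by
    constructor
    · refine Polynomial.monic_of_injective (algebraMap k (AlgebraicClosure k)).injective ?_
      rw [h]
      exact Polynomial.monic_prod_X_sub_C _ _
    · rw [← Polynomial.natDegree_map (algebraMap k (AlgebraicClosure k)), h,
        Polynomial.natDegree_finsetProd_X_sub_C_eq_card, Finset.card_univ, Fintype.card_fin]
  have heval {p : Polynomial k} {c : Fin n → AlgebraicClosure k}
      (h : p.map (algebraMap k (AlgebraicClosure k)) =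
        ∏ i, (Polynomial.X - Polynomial.C (c i))) (x : k) :
      algebraMap k (AlgebraicClosure k) (p.eval x) =
        ∏ i, (algebraMap k (AlgebraicClosure k) x - c i) := by
    rw [← Polynomial.eval_map_apply, h, Polynomial.eval_prod]
    simp
  refine exists_matrix_charpoly_eval_eq (hmonic hpa).1 (hmonic hpb).1 (hmonic hpa).2
    (hmonic hpb).2 ?_ ?_ ?_ ?_
  · rw [← (algebraMap k (AlgebraicClosure k)).injective.ne_iff, heval hpa, map_zero]
    exact Finset.prod_ne_zero_iff.2 fun i _ => by simpa using ha0 i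
  · rw [← (algebraMap k (AlgebraicClosure k)).injective.ne_iff, heval hpa, map_zero, map_one]
    exact Finset.prod_ne_zero_iff.2 fun i _ => sub_ne_zero.2 (ha1 i).symm
  · apply (algebraMap k (AlgebraicClosure k)).injective
    simp only [heval hpa, heval hpb, map_zero, zero_sub, Finset.prod_neg, hprod]
  · apply (algebraMap k (AlgebraicClosure k)).injective
    simpa only [heval hpa, heval hpb, map_one] using hprod1
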